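/- For all sufficiently large integers h, there exists a symmetric 0/1 matrix A of dimensions 2h × 2h such that him(A) ≤ 10·log₂ h and mimsup(A) ≥ √h. -/

import Mathlib

open Filter

section Defs

variable {I J K L : Type*}

/-- The matrix `M` has an `m × m` identity submatrix after permutation
(an induced matching of size `m`). -/
def HasMim (M : I → J → Prop) (m : ℕ) : Prop :=
  ∃ (r : Fin m → I) (c : Fin m → J), Function.Injective r ∧ Function.Injective c ∧
    ∀ i j, M (r i) (c j) ↔ i = j

/-- `mim M` is the largest `m` such that `M` has an `m × m` identity submatrix
after permutation. -/
noncomputable def mim (M : I → J → Prop) : ℕ := sSup {m | HasMim M m}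

/-- The matrix `M` has a half-induced matching of size `m`. -/
def HasHim (M : I → J → Prop) (m : ℕ) : Prop :=
  ∃ (r : Fin m → I) (c : Fin m → J), Function.Injective r ∧ Function.Injective c ∧
    (∀ i, M (r i) (c i)) ∧ ∀ i j : Fin m, i < j → ¬ M (r i) (c j)

/-- `him M` is the largest `m` such that `M` has a half-induced matching of size `m`. -/
noncomputable def him (M : I → J → Prop) : ℕ := sSup {m | HasHim M m}

/-- Kronecker product of two 0/1 (`Prop`-valued) matrices. -/
def kron (M : I → J → Prop) (N : K → L → Prop) : I × K → J × L → Prop :=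
  fun p q => M p.1 q.1 ∧ N p.2 q.2

/-- `k`-fold Kronecker power of a 0/1 (`Prop`-valued) matrix. -/
def kronPow (M : I → J → Prop) (k : ℕ) : (Fin k → I) → (Fin k → J) → Prop :=
  fun r c => ∀ t, M (r t) (c t)

/-- `mimsup M = limsup_{k → ∞} mim (M^{⊗ k}) ^ (1/k)`. -/
noncomputable def mimsup (M : I → J → Prop) : ℝ :=
  Filter.atTop.limsup fun k : ℕ => (mim (kronPow M k) : ℝ) ^ (1 / (k : ℝ))

/-- `𝒜'` is a subset of `𝒜` that `M`-represents `𝒜`. -/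
def Represents (M : I → J → Prop) (𝒜 𝒜' : Set I) : Prop :=
  𝒜' ⊆ 𝒜 ∧ ∀ j, (∃ i ∈ 𝒜, M i j) → ∃ i' ∈ 𝒜', M i' j

end Defs

section Tournament

variable {V : Type*} [LinearOrder V]

/-- The reflexive tournament on `V` that orients each pair `i < j` according to `f (i, j)`. -/
def tournament (f : V × V → Bool) (i j : V) : Prop :=
  i = j ∨ (i < j ∧ f (i, j) = true) ∨ (j < i ∧ f (j, i) = false)

lemma tournament_total (f : V × V → Bool) (i j : V) : tournament f i j ∨ tournament f j i := by
  unfold tournament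
  rcases lt_trichotomy i j with h | h | h
  · cases hf : f (i, j) <;> simp [h]
  · exact Or.inl (Or.inl h)
  · cases hf : f (j, i) <;> simp [h]

lemma tournament_and_swap_iff (f : V × V → Bool) (i j : V) :
    tournament f i j ∧ tournament f j i ↔ i = j := by
  unfold tournament
  constructor
  · rintro ⟨h1 | ⟨h1, h1f⟩ | ⟨h1, h1f⟩, h2 | ⟨h2, h2f⟩ | ⟨h2, h2f⟩⟩
    all_goals first
      | exact h1
      | exact h2.symm
      | exact absurd h1 h2.asymm
      | simp_all
  · rintro rfl
    simp

/-- A non-edge of the tournament determines the orientation of the corresponding pair. -/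
lemma apply_eq_of_not_tournament {f : V × V → Bool} {i j : V} (h : ¬ tournament f i j) :
    f (min i j, max i j) = decide (j < i) := by
  unfold tournament at h
  push Not at h
  obtain ⟨hne, h1, h2⟩ := h
  rcases lt_or_gt_of_ne hne with hlt | hlt
  · simpa [hlt.le, hlt.not_gt] using h1 hlt
  · simpa [hlt.le, hlt] using h2 hlt

open Classical in
lemma card_filter_eq_comp_mul_two_pow {X P : Type*} [Fintype X] [DecidableEq X] [Fintype P] [DecidableEq P] (pos : P → X)
    (hpos : Function.Injective pos) (v : P → Bool) :
    (Finset.univ.filter fun f : X → Bool => ∀ p, f (pos p) = v p).card * 2 ^ Fintype.card P ≤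
      2 ^ Fintype.card X := by
  let Φ : {f : X → Bool // ∀ p, f (pos p) = v p} × (P → Bool) → (X → Bool) :=
    fun q x => if h : ∃ p, pos p = x then q.2 h.choose else q.1.1 x
  have hΦ : Function.Injective Φ := by
    rintro ⟨⟨f, hf⟩, g⟩ ⟨⟨f', hf'⟩, g'⟩ h
    have hg : g = g' := by
      funext p
      have hp : ∃ p', pos p' = pos p := ⟨p, rfl⟩
      have := congrFun h (pos p)
      simpa only [Φ, dif_pos hp, hpos hp.choose_spec] using this
    have hff : f = f' := by
      funext x
      by_cases hx : ∃ p, pos p = x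
      · obtain ⟨p, rfl⟩ := hx
        rw [hf, hf']
      · simpa only [Φ, dif_neg hx] using congrFun h x
    subst hg hff
    rfl
  have := Fintype.card_le_of_injective Φ hΦ
  rw [Fintype.card_prod, Fintype.card_subtype] at this
  simpa using this

lemma card_sigma_fin_mul_two (m : ℕ) :
    Fintype.card (Σ j : Fin m, Fin (j : ℕ)) * 2 = m * (m - 1) := by
  rw [Fintype.card_sigma]
  simp only [Fintype.card_fin]
  rw [Fin.sum_univ_eq_sum_range (fun i => i), Finset.sum_range_id_mul_two]

open Classical in
lemma card_tournaments_with_halfInduced_le [Fintype V] {m : ℕ} {a b : Fin m → V}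
    (ha : Function.Injective a) (hb : Function.Injective b) :
    (Finset.univ.filter fun f : V × V → Bool =>
        ∀ k j : Fin m, k < j → ¬ tournament f (a k) (b j)).card *
        2 ^ Fintype.card (Σ j : Fin m, Fin (j : ℕ)) ≤ 2 ^ Fintype.card (V × V) := by
  rcases Finset.eq_empty_or_nonempty (Finset.univ.filter fun f : V × V → Bool =>
        ∀ k j : Fin m, k < j → ¬ tournament f (a k) (b j)) with h | ⟨f₀, hf₀⟩
  · simp [h]
  replace hf₀ := (Finset.mem_filter.1 hf₀).2
  let fst : (Σ j : Fin m, Fin (j : ℕ)) → Fin m := fun p => Fin.castLE p.1.2.le p.2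
  have hlt : ∀ p, fst p < p.1 := fun p => p.2.2
  let pos : (Σ j : Fin m, Fin (j : ℕ)) → V × V :=
    fun p => (min (a (fst p)) (b p.1), max (a (fst p)) (b p.1))
  have hpos : Function.Injective pos := by
    intro p q hpq
    have h1 : min (a (fst p)) (b p.1) = min (a (fst q)) (b q.1) := congrArg Prod.fst hpq
    have h2 : max (a (fst p)) (b p.1) = max (a (fst q)) (b q.1) := congrArg Prod.snd hpq
    have key : (a (fst p) = a (fst q) ∧ b p.1 = b q.1) ∨
        (a (fst p) = b q.1 ∧ b p.1 = a (fst q)) := by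
      rcases le_total (a (fst p)) (b p.1) with h | h <;>
        rcases le_total (a (fst q)) (b q.1) with h' | h' <;>
        simp only [h, h', min_eq_left, min_eq_right, max_eq_left, max_eq_right] at h1 h2 <;>
        simp [h1, h2]
    rcases key with ⟨e1, e2⟩ | ⟨e1, e2⟩
    · have e3 := hb e2
      have e4 := ha e1
      obtain ⟨j, k⟩ := p
      obtain ⟨j', k'⟩ := q
      obtain rfl : j = j' := e3
      have : k = k' := by simpa [fst, Fin.ext_iff] using e4
      rw [this]
    · have n1 := hf₀ _ _ (hlt p)
      have n2 := hf₀ _ _ (hlt q)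
      rw [← e1, ← e2] at n2
      exact absurd (tournament_total f₀ _ _) (not_or.2 ⟨n1, n2⟩)
  refine le_trans (Nat.mul_le_mul_right _ (Finset.card_le_card ?_))
    (card_filter_eq_comp_mul_two_pow pos hpos fun p => decide (b p.1 < a (fst p)))
  intro f hf
  refine Finset.mem_filter.2 ⟨Finset.mem_univ _, fun p => ?_⟩
  exact apply_eq_of_not_tournament ((Finset.mem_filter.1 hf).2 _ _ (hlt p))

open Classical in
/-- Erdős-type counting bound: some tournament has no large half-induced matching. -/
lemma exists_tournament_not_hasHim [Fintype V] {m : ℕ}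
    (hm : (Fintype.card V ^ m) ^ 2 < 2 ^ Fintype.card (Σ j : Fin m, Fin (j : ℕ))) :
    ∃ f : V × V → Bool, ¬ HasHim (tournament f) m := by
  by_contra! hall
  let S : (Fin m → V) × (Fin m → V) → Finset (V × V → Bool) := fun ab =>
    Finset.univ.filter fun f => Function.Injective ab.1 ∧ Function.Injective ab.2 ∧
      ∀ k j : Fin m, k < j → ¬ tournament f (ab.1 k) (ab.2 j)
  have hS : ∀ ab, (S ab).card * 2 ^ Fintype.card (Σ j : Fin m, Fin (j : ℕ)) ≤
      2 ^ Fintype.card (V × V) := by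
    rintro ⟨a, b⟩
    by_cases hab : Function.Injective a ∧ Function.Injective b
    · refine le_trans (Nat.mul_le_mul_right _ (Finset.card_le_card ?_))
        (card_tournaments_with_halfInduced_le hab.1 hab.2)
      intro f hf
      exact Finset.mem_filter.2 ⟨Finset.mem_univ _, (Finset.mem_filter.1 hf).2.2.2⟩
    · have : S (a, b) = ∅ :=
        Finset.filter_eq_empty_iff.2 fun f _ hf => hab ⟨hf.1, hf.2.1⟩
      simp [this]
  have hcover : (Finset.univ : Finset (V × V → Bool)) ⊆ Finset.univ.biUnion S := by
    intro f _
    obtain ⟨a, b, ha, hb, -, h0⟩ := hall f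
    exact Finset.mem_biUnion.2
      ⟨(a, b), Finset.mem_univ _, Finset.mem_filter.2 ⟨Finset.mem_univ _, ha, hb, h0⟩⟩
  have hN : 2 ^ Fintype.card (V × V) ≤ ∑ ab, (S ab).card := by
    have := (Finset.card_le_card hcover).trans Finset.card_biUnion_le
    simpa only [Finset.card_univ, Fintype.card_fun, Fintype.card_bool] using this
  have hle : 2 ^ Fintype.card (V × V) * 2 ^ Fintype.card (Σ j : Fin m, Fin (j : ℕ)) ≤
      2 ^ Fintype.card (V × V) * (Fintype.card V ^ m) ^ 2 := by
    calc _ ≤ (∑ ab, (S ab).card) * 2 ^ Fintype.card (Σ j : Fin m, Fin (j : ℕ)) :=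
          Nat.mul_le_mul_right _ hN
      _ = ∑ ab, (S ab).card * 2 ^ Fintype.card (Σ j : Fin m, Fin (j : ℕ)) := Finset.sum_mul _ _ _
      _ ≤ ∑ _ab : (Fin m → V) × (Fin m → V), 2 ^ Fintype.card (V × V) :=
          Finset.sum_le_sum fun ab _ => hS ab
      _ = 2 ^ Fintype.card (V × V) * (Fintype.card V ^ m) ^ 2 := by
          rw [Finset.sum_const, Finset.card_univ, Fintype.card_prod, Fintype.card_fun,
            Fintype.card_fin, smul_eq_mul]
          ring
  exact absurd (Nat.le_of_mul_le_mul_left hle (by positivity)) (not_le.2 hm)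

end Tournament

section Bipartite

variable {V : Type*}

/-- The symmetric block matrix with off-diagonal blocks `B` and `Bᵀ`. -/
def bipartiteDouble (B : V → V → Prop) (p q : Fin 2 × V) : Prop :=
  (p.1 = 0 ∧ q.1 = 1 ∧ B p.2 q.2) ∨ (p.1 = 1 ∧ q.1 = 0 ∧ B q.2 p.2)

lemma bipartiteDouble_comm (B : V → V → Prop) (p q : Fin 2 × V) :
    bipartiteDouble B p q ↔ bipartiteDouble B q p := by
  unfold bipartiteDouble
  tauto

lemma exists_halfInduced_of_le_card {I J : Type*} {M : I → J → Prop} {n : ℕ} {r : Fin n → I} {c : Fin n → J} {m : ℕ}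
    (hr : Function.Injective r) (hc : Function.Injective c) (h1 : ∀ i, M (r i) (c i))
    (h0 : ∀ i j, i < j → ¬ M (r i) (c j)) {s : Finset (Fin n)} (hs : m ≤ s.card) :
    ∃ (r' : Fin m → I) (c' : Fin m → J), Function.Injective r' ∧ Function.Injective c' ∧
      (∀ i, M (r' i) (c' i)) ∧ (∀ i j, i < j → ¬ M (r' i) (c' j)) ∧
      ∀ i, ∃ k ∈ s, r' i = r k ∧ c' i = c k := by
  let e := s.orderEmbOfCardLe hs
  exact ⟨r ∘ e, c ∘ e, hr.comp e.injective, hc.comp e.injective, fun i => h1 _,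
    fun i j hij => h0 _ _ (e.strictMono hij),
    fun i => ⟨e i, s.orderEmbOfCardLe_mem hs i, rfl, rfl⟩⟩

lemma HasHim.le_of_bipartiteDouble {B : V → V → Prop} {m : ℕ} (hB : ¬ HasHim B (m + 1)) {n : ℕ}
    (h : HasHim (bipartiteDouble B) n) : n ≤ 2 * m := by
  obtain ⟨r, c, hr, hc, h1, h0⟩ := h
  by_contra! hn
  have hsum := Finset.card_filter_add_card_filter_not (s := (Finset.univ : Finset (Fin n)))
    (fun i => (r i).1 = 0)
  rw [Finset.card_univ, Fintype.card_fin] at hsum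
  rcases (by omega : m + 1 ≤ (Finset.univ.filter fun i => (r i).1 = 0).card ∨
      m + 1 ≤ (Finset.univ.filter fun i => ¬ (r i).1 = 0).card) with hs | hs
  · obtain ⟨r', c', hr', hc', h1', h0', hmem⟩ := exists_halfInduced_of_le_card hr hc h1 h0 hs
    have hr0 : ∀ i, (r' i).1 = 0 := fun i => by
      obtain ⟨k, hk, e, -⟩ := hmem i
      rw [e]
      exact (Finset.mem_filter.1 hk).2
    have hc0 : ∀ i, (c' i).1 = 1 := fun i => by
      have : (c' i).1 = 1 ∧ B (r' i).2 (c' i).2 := by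
        simpa [bipartiteDouble, hr0] using h1' i
      exact this.1
    refine hB ⟨fun i => (r' i).2, fun i => (c' i).2,
      fun i j hij => hr' (Prod.ext ((hr0 i).trans (hr0 j).symm) hij),
      fun i j hij => hc' (Prod.ext ((hc0 i).trans (hc0 j).symm) hij), fun i => ?_,
      fun i j hij => ?_⟩
    · simpa [bipartiteDouble, hr0, hc0] using h1' i
    · simpa [bipartiteDouble, hr0, hc0] using h0' i j hij
  · obtain ⟨r', c', hr', hc', h1', h0', hmem⟩ := exists_halfInduced_of_le_card hr hc h1 h0 hs
    have hr0 : ∀ i, (r' i).1 = 1 := fun i => by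
      obtain ⟨k, hk, e, -⟩ := hmem i
      have := (Finset.mem_filter.1 hk).2
      rw [e]
      omega
    have hc0 : ∀ i, (c' i).1 = 0 := fun i => by
      have : (c' i).1 = 0 ∧ B (c' i).2 (r' i).2 := by
        simpa [bipartiteDouble, hr0] using h1' i
      exact this.1
    refine hB ⟨fun i => (c' i.rev).2, fun i => (r' i.rev).2,
      fun i j hij => Fin.rev_injective (hc' (Prod.ext ((hc0 _).trans (hc0 _).symm) hij)),
      fun i j hij => Fin.rev_injective (hr' (Prod.ext ((hr0 _).trans (hr0 _).symm) hij)),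
      fun i => ?_, fun i j hij => ?_⟩
    · simpa [bipartiteDouble, hr0, hc0] using h1' i.rev
    · simpa [bipartiteDouble, hr0, hc0] using h0' j.rev i.rev (Fin.rev_lt_rev.2 hij)

lemma hasHim_comp_equiv {I J : Type*} {M : I → I → Prop} (e : J ≃ I) {n : ℕ}
    (h : HasHim (fun i j => M (e i) (e j)) n) : HasHim M n := by
  obtain ⟨r, c, hr, hc, h1, h0⟩ := h
  exact ⟨e ∘ r, e ∘ c, e.injective.comp hr, e.injective.comp hc, h1, h0⟩

end Bipartite

section Mim

variable {I J : Type*}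

lemma HasMim.le_card [Fintype I] {M : I → J → Prop} {m : ℕ} (h : HasMim M m) :
    m ≤ Fintype.card I := by
  obtain ⟨r, -, hr, -⟩ := h
  simpa using Fintype.card_le_of_injective r hr

lemma mim_le_card [Fintype I] (M : I → J → Prop) : mim M ≤ Fintype.card I :=
  csSup_le' fun _ h => HasMim.le_card h

lemma HasMim.le_mim [Fintype I] {M : I → J → Prop} {m : ℕ} (h : HasMim M m) : m ≤ mim M :=
  le_csSup ⟨Fintype.card I, fun _ h => HasMim.le_card h⟩ h

lemma hasMim_of_forall_iff {M : I → J → Prop} {X : Type*} {m : ℕ} (e : Fin m ≃ X) (r : X → I)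
    (c : X → J) (h : ∀ x y, M (r x) (c y) ↔ x = y) : HasMim M m := by
  refine ⟨r ∘ e, c ∘ e, fun i j hij => ?_, fun i j hij => ?_, fun i j => ?_⟩
  · have hij' : r (e i) = r (e j) := hij
    exact e.injective ((h _ _).1 (hij' ▸ (h (e j) (e j)).2 rfl))
  · have hij' : c (e i) = c (e j) := hij
    exact e.injective ((h _ _).1 (hij' ▸ (h (e i) (e i)).2 rfl))
  · exact (h _ _).trans e.injective.eq_iff

lemma hasMim_kronPow_bipartiteDouble {h : ℕ} {B : Fin h → Fin h → Prop}
    (hB : ∀ i j, B i j ∧ B j i ↔ i = j) {I : Type*} (e : I ≃ Fin 2 × Fin h) (t : ℕ) :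
    HasMim (kronPow (fun i j : I => bipartiteDouble B (e i) (e j)) (2 * t)) (h ^ t) := by
  refine hasMim_of_forall_iff finFunctionFinEquiv.symm
    (fun x s => e.symm ((finProdFinEquiv.symm s).1, x (finProdFinEquiv.symm s).2))
    (fun x s => e.symm ((finProdFinEquiv.symm s).1 + 1, x (finProdFinEquiv.symm s).2))
    fun x y => ?_
  simp only [kronPow, Equiv.apply_symm_apply]
  constructor
  · intro H
    funext i
    have h0 := H (finProdFinEquiv (0, i))
    have h1 := H (finProdFinEquiv (1, i))
    simp only [bipartiteDouble, Equiv.symm_apply_apply] at h0 h1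
    exact (hB _ _).1 ⟨by simpa using h0, by simpa using h1⟩
  · rintro rfl s
    have hrefl : ∀ i, B i i := fun i => ((hB i i).2 rfl).1
    generalize finProdFinEquiv.symm s = p
    obtain ⟨k, i⟩ := p
    fin_cases k <;> simp [bipartiteDouble, hrefl]

lemma sqrt_le_mimsup [Fintype I] {M : I → J → Prop} {h : ℕ}
    (hM : ∀ t, HasMim (kronPow M (2 * t)) (h ^ t)) : Real.sqrt h ≤ mimsup M := by
  refine Filter.le_limsup_of_frequently_le ?_ ⟨Fintype.card I, ?_⟩
  · refine Filter.frequently_atTop.2 fun n => ⟨2 * (n + 1), by omega, ?_⟩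
    have hle : ((h ^ (n + 1) : ℕ) : ℝ) ≤ mim (kronPow M (2 * (n + 1))) :=
      Nat.cast_le.2 (hM (n + 1)).le_mim
    calc Real.sqrt h = ((Real.sqrt h) ^ (2 * (n + 1))) ^ (1 / ((2 * (n + 1) : ℕ) : ℝ)) := by
          rw [one_div, Real.pow_rpow_inv_natCast (Real.sqrt_nonneg _) (by omega)]
      _ = ((h ^ (n + 1) : ℕ) : ℝ) ^ (1 / ((2 * (n + 1) : ℕ) : ℝ)) := by
          rw [pow_mul, Real.sq_sqrt (Nat.cast_nonneg h), Nat.cast_pow]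
      _ ≤ _ := Real.rpow_le_rpow (Nat.cast_nonneg _) hle (by positivity)
  · rw [Filter.eventually_map]
    filter_upwards [Filter.eventually_ge_atTop 1] with k hk
    have hle : (mim (kronPow M k) : ℝ) ≤ (Fintype.card I : ℝ) ^ k := by
      have := mim_le_card (kronPow M k)
      rw [Fintype.card_fun, Fintype.card_fin] at this
      exact_mod_cast this
    calc _ ≤ ((Fintype.card I : ℝ) ^ k) ^ (1 / (k : ℝ)) :=
          Real.rpow_le_rpow (Nat.cast_nonneg _) hle (by positivity)
      _ = Fintype.card I := by
          rw [one_div, Real.pow_rpow_inv_natCast (Nat.cast_nonneg _) (by omega)]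

end Mim

theorem stmt9 : ∃ h₀ : ℕ, ∀ h : ℕ, h₀ ≤ h →
    ∃ A : Fin (2 * h) → Fin (2 * h) → Prop,
      (∀ i j, A i j ↔ A j i) ∧
      (him A : ℝ) ≤ 10 * Real.logb 2 h ∧
      Real.sqrt h ≤ mimsup A := by
  refine ⟨16, fun h hh => ?_⟩
  set L := Nat.log 2 h + 1
  have hlt : h < 2 ^ L := Nat.lt_pow_succ_log_self (by norm_num) h
  have hcard : Fintype.card (Σ j : Fin (4 * L + 1), Fin (j : ℕ)) = L * 2 * (4 * L + 1) := by
    have := card_sigma_fin_mul_two (4 * L + 1)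
    rw [Nat.add_sub_cancel] at this
    linarith
  obtain ⟨f, hf⟩ := exists_tournament_not_hasHim (V := Fin h) (m := 4 * L + 1) (by
    rw [hcard, Fintype.card_fin, ← pow_mul, mul_comm (4 * L + 1) 2, mul_assoc,
      pow_mul 2 L]
    exact Nat.pow_lt_pow_left hlt (by omega))
  refine ⟨fun i j => bipartiteDouble (tournament f) (finProdFinEquiv.symm i)
    (finProdFinEquiv.symm j), fun i j => bipartiteDouble_comm _ _ _, ?_,
    sqrt_le_mimsup (hasMim_kronPow_bipartiteDouble (tournament_and_swap_iff f) _)⟩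
  have hhim : him (fun i j => bipartiteDouble (tournament f) (finProdFinEquiv.symm i)
      (finProdFinEquiv.symm j)) ≤ 2 * (4 * L) :=
    csSup_le' fun n hn => (hasHim_comp_equiv finProdFinEquiv.symm hn).le_of_bipartiteDouble hf
  have hlog : (Nat.log 2 h : ℝ) ≤ Real.logb 2 h := by
    simpa using Real.natLog_le_logb h 2
  have h4 : 4 ≤ Nat.log 2 h := Nat.le_log_of_pow_le (by norm_num) (by omega)
  have h4' : (4 : ℝ) ≤ Nat.log 2 h := by exact_mod_cast h4
  have hhim' : (him (fun i j => bipartiteDouble (tournament f) (finProdFinEquiv.symm i)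
      (finProdFinEquiv.symm j)) : ℝ) ≤ 2 * (4 * (Nat.log 2 h + 1)) := by
    exact_mod_cast hhim
  linarith
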